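/- Let P be a p-subgroup of the finite group G and let n be a natural number such that J(F·Z(P))^n = 0, where Z(P) is the center of P. Then I_{≤P}(G) · J(Z(FG))^n ⊆ I_{<P}(G). -/

import Mathlib

set_option synthInstance.maxHeartbeats 1000000
set_option maxHeartbeats 1000000

open scoped Classical

/-- The class sum `K⁺ = ∑_{x ∈ K} x` of a conjugacy class `K` in the group algebra `FG`. -/
noncomputable def classSum (F : Type) [Field F] {G : Type} [Group G] [Fintype G]
    (K : ConjClasses G) : MonoidAlgebra F G :=
  ∑ x : G, if x ∈ K.carrier then MonoidAlgebra.single x (1 : F) else 0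

/-- `P` is a defect group of the conjugacy class `K`: `P` is a Sylow `p`-subgroup of the
centralizer of some element of `K`. -/
def IsClassDefectGroup {G : Type} [Group G] (p : ℕ) (P : Subgroup G) (K : ConjClasses G) : Prop :=
  ∃ x ∈ K.carrier, ∃ S : Sylow p ↥(Subgroup.centralizer {x}),
    P = Subgroup.map (Subgroup.centralizer {x}).subtype S.toSubgroup

/-- `I_P(G)`: the `F`-span of the class sums of conjugacy classes with defect group `P`. -/
noncomputable def classIdeal (F : Type) [Field F] {G : Type} [Group G] [Fintype G]
    (p : ℕ) (P : Subgroup G) : Submodule F (MonoidAlgebra F G) :=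
  Submodule.span F {a | ∃ K : ConjClasses G, IsClassDefectGroup p P K ∧ a = classSum F K}

/-- `I_{≤P}(G) = ∑_{Q ≤ P} I_Q(G)`. -/
noncomputable def classIdealLE (F : Type) [Field F] {G : Type} [Group G] [Fintype G]
    (p : ℕ) (P : Subgroup G) : Submodule F (MonoidAlgebra F G) :=
  ⨆ Q ≤ P, classIdeal F p Q

/-- `I_{<P}(G) = ∑_{Q < P} I_Q(G)`. -/
noncomputable def classIdealLT (F : Type) [Field F] {G : Type} [Group G] [Fintype G]
    (p : ℕ) (P : Subgroup G) : Submodule F (MonoidAlgebra F G) :=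
  ⨆ Q < P, classIdeal F p Q

/-- The Jacobson radical `J(Z(FG))` of the center of the group algebra, viewed as an
`F`-submodule of `FG`. -/
noncomputable def JZ (F : Type) [Field F] (G : Type) [Group G] [Fintype G] :
    Submodule F (MonoidAlgebra F G) :=
  Submodule.map (Subalgebra.center F (MonoidAlgebra F G)).val.toLinearMap
    ((Ideal.jacobson (⊥ : Ideal ↥(Subalgebra.center F (MonoidAlgebra F G)))).restrictScalars F)

section SumLemmas

variable {F : Type*} [Field F]

/-- A sum over a finite set with a group action vanishes if it vanishes on every orbit. -/
theorem sum_eq_zero_of_sum_orbit_eq_zero {R α : Type*} [Group R] [MulAction R α] [Fintype α]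
    (f : α → F) (h : ∀ x : α, ∑ y : MulAction.orbit R x, f y = 0) : ∑ x, f x = 0 := by
  rw [← (MulAction.selfEquivSigmaOrbits R α).symm.sum_comp, Fintype.sum_sigma]
  exact Finset.sum_eq_zero fun ω _ ↦ h ω.out

/-- A sum of a function invariant under the action of a `p`-group may be restricted to the
fixed points in characteristic `p`. -/
theorem IsPGroup.sum_eq_sum_fixed {p : ℕ} [Fact p.Prime] [CharP F p] {R α : Type*} [Group R]
    [Finite R] (hR : IsPGroup p R) [Fintype α] (ρ : R →* Equiv.Perm α) (f : α → F)
    (hf : ∀ r x, f (ρ r x) = f x) :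
    ∑ x, f x = ∑ x, if ∀ r, ρ r x = x then f x else 0 := by
  let _ : MulAction R α := MulAction.compHom α ρ
  have hs (r : R) (x : α) : r • x = ρ r x := rfl
  rw [← sub_eq_zero, ← Finset.sum_sub_distrib]
  refine sum_eq_zero_of_sum_orbit_eq_zero (R := R) _ fun x ↦ ?_
  by_cases hx : ∀ r, ρ r x = x
  · refine Finset.sum_eq_zero ?_
    rintro ⟨y, r, rfl⟩ -
    simp [hs, hx]
  · obtain ⟨n, hn⟩ := hR.card_orbit x
    have hn0 : n ≠ 0 := by
      rintro rfl
      have : Subsingleton (MulAction.orbit R x) := by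
        rw [← Finite.card_le_one_iff_subsingleton, hn, pow_zero]
      exact hx fun r ↦ congrArg Subtype.val
        (Subsingleton.elim (⟨r • x, MulAction.mem_orbit x r⟩ : MulAction.orbit R x)
          ⟨x, MulAction.mem_orbit_self x⟩)
    have key (y : MulAction.orbit R x) :
        f y - (if ∀ r, ρ r y = y then f y else 0) = f x := by
      obtain ⟨y, r, rfl⟩ := y
      have : ¬ ∀ s, ρ s (ρ r x) = ρ r x := fun h ↦ hx fun s ↦ by
        have h1 := h r⁻¹
        rw [← Equiv.Perm.mul_apply, ← map_mul] at h1
        simp only [inv_mul_cancel, map_one, Equiv.Perm.one_apply] at h1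
        have h2 := h s
        rwa [← h1] at h2
      simp only [hs, if_neg this, hf, sub_zero]
    rw [Finset.sum_congr rfl fun y _ ↦ key y, Finset.sum_const, Finset.card_univ,
      ← Nat.card_eq_fintype_card, hn, nsmul_eq_mul, Nat.cast_pow, CharP.cast_eq_zero,
      zero_pow hn0, zero_mul]

/-- Summing over a group amounts to summing over an orbit, up to the order of the stabilizer. -/
theorem sum_smul_eq_card_stabilizer_mul_sum_orbit {R α : Type*} [Group R] [MulAction R α]
    [Fintype R] [Fintype α] (f : α → F) (x : α) :
    ∑ r : R, f (r • x) =
      (Nat.card (MulAction.stabilizer R x) : F) * ∑ y : MulAction.orbit R x, f y := by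
  let e := MulAction.orbitProdStabilizerEquivGroup R x
  have he (y : MulAction.orbit R x × MulAction.stabilizer R x) : e y • x = y.1 := by
    obtain ⟨r, rfl⟩ := e.symm.surjective y
    rw [e.apply_symm_apply]
    rfl
  rw [← e.sum_comp, Fintype.sum_prod_type]
  simp [he, Finset.mul_sum]

end SumLemmas

section ClassFunctions

variable {F G : Type*} [Field F] [Group G]

theorem MonoidAlgebra.coeff_mul_eq_sum [Fintype G] (a b : MonoidAlgebra F G) (g : G) :
    (a * b).coeff g = ∑ x, a.coeff x * b.coeff (x⁻¹ * g) := by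
  rw [MonoidAlgebra.coeff_mul_apply_left, Finsupp.sum_fintype _ _ (by simp)]

/-- The coefficients of `a` are constant on conjugacy classes. -/
def IsClassFunction (a : MonoidAlgebra F G) : Prop :=
  ∀ h g, a.coeff (h * g * h⁻¹) = a.coeff g

theorem isClassFunction_iff_mem_center {a : MonoidAlgebra F G} :
    IsClassFunction a ↔ a ∈ Subalgebra.center F (MonoidAlgebra F G) := by
  rw [Subalgebra.mem_center_iff]
  constructor
  · intro ha b
    induction b using MonoidAlgebra.induction_on with
    | of g =>
      ext x
      simpa [mul_assoc] using (ha g⁻¹ (x * g⁻¹)).trans (by simp)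
    | add x y hx hy => rw [add_mul, mul_add, hx, hy]
    | smul r x hx => rw [smul_mul_assoc, mul_smul_comm, hx]
  · intro ha h g
    have := congrArg (fun b ↦ b.coeff (h * g)) (ha (MonoidAlgebra.single h 1))
    simpa using this.symm

namespace IsClassFunction

variable {a b : MonoidAlgebra F G}

theorem mul (ha : IsClassFunction a) (hb : IsClassFunction b) : IsClassFunction (a * b) := by
  rw [isClassFunction_iff_mem_center] at *
  exact mul_mem ha hb

theorem commute (ha : IsClassFunction a) (b : MonoidAlgebra F G) : Commute a b :=
  (Subalgebra.mem_center_iff.1 (isClassFunction_iff_mem_center.1 ha) b).symm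

theorem coeff_mul_comm (ha : IsClassFunction a) (x y : G) :
    a.coeff (x * y) = a.coeff (y * x) := by
  rw [← ha y (x * y)]
  group

theorem map {H : Type*} [Group H] {π : G →* H} (hπ : Function.Surjective π)
    (ha : IsClassFunction a) :
    IsClassFunction (MonoidAlgebra.mapDomainRingHom F π a) := by
  rw [isClassFunction_iff_mem_center, Subalgebra.mem_center_iff] at *
  intro b
  have hs : Function.Surjective (MonoidAlgebra.mapDomainRingHom F π) := by
    intro b
    induction b using MonoidAlgebra.induction_on with
    | of h =>
      obtain ⟨g, rfl⟩ := hπ h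
      exact ⟨.single g 1, by simp⟩
    | add x y hx hy =>
      obtain ⟨⟨x, rfl⟩, y, rfl⟩ := And.intro hx hy
      exact ⟨x + y, map_add _ _ _⟩
    | smul r x hx =>
      obtain ⟨x, rfl⟩ := hx
      exact ⟨r • x, map_smul (MonoidAlgebra.mapDomainAlgHom F F π) r x⟩
  obtain ⟨b, rfl⟩ := hs b
  rw [← map_mul, ← map_mul, ha]

/-- The coefficient of a product of class functions at an element centralized by a
`p`-subgroup `R` only involves elements centralized by `R`. -/
theorem coeff_mul_eq_sum_centralizer [Fintype G] {p : ℕ} [Fact p.Prime] [CharP F p]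
    (ha : IsClassFunction a) (hb : IsClassFunction b) {R : Subgroup G} (hR : IsPGroup p R)
    {g : G} (hg : g ∈ Subgroup.centralizer (R : Set G)) :
    (a * b).coeff g = ∑ x, if x ∈ Subgroup.centralizer (R : Set G) then
      a.coeff x * b.coeff (x⁻¹ * g) else 0 := by
  rw [MonoidAlgebra.coeff_mul_eq_sum,
    hR.sum_eq_sum_fixed ((MulAut.toPerm G).comp (MulAut.conj.comp R.subtype))]
  · refine Finset.sum_congr rfl fun x _ ↦ ?_
    have hx : (∀ r : R, ((MulAut.toPerm G).comp (MulAut.conj.comp R.subtype)) r x = x) ↔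
        x ∈ Subgroup.centralizer (R : Set G) := by
      rw [Subgroup.mem_centralizer_iff, Subtype.forall]
      exact forall₂_congr fun r _ ↦ mul_inv_eq_iff_eq_mul
    simp only [hx]
  · rintro ⟨r, hr⟩ x
    have h1 : g = r * g * r⁻¹ := by
      rw [Subgroup.mem_centralizer_iff.1 hg r hr, mul_inv_cancel_right]
    have h2 : (r * x * r⁻¹)⁻¹ * g = r * (x⁻¹ * g) * r⁻¹ := by
      nth_rw 1 [h1]
      group
    change a.coeff (r * x * r⁻¹) * b.coeff ((r * x * r⁻¹)⁻¹ * g) = _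
    rw [h2, ha r x, hb r (x⁻¹ * g)]

end IsClassFunction

/-- The regular representation has zero trace on `x⁻¹ z`, composed with right multiplication by
`g⁻¹`, when `z` is central and nilpotent. -/
theorem sum_coeff_conj_mul_eq_zero [Fintype G] {z : MonoidAlgebra F G} (hz : IsClassFunction z)
    (hnil : IsNilpotent z) (x g : G) : ∑ h : G, z.coeff (h * x * h⁻¹ * g) = 0 := by
  let a : MonoidAlgebra F G := .single x⁻¹ 1 * z
  have ha : IsNilpotent a := (hz.commute _).symm.isNilpotent_mul_left hnil
  let T : Module.End F (MonoidAlgebra F G) :=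
    LinearMap.mulRight F (.single g⁻¹ 1) * LinearMap.mulLeft F a
  have hT : IsNilpotent T :=
    (LinearMap.commute_mulLeft_right (R := F) _ _).symm.isNilpotent_mul_left
      (ha.map (Algebra.lmul F (MonoidAlgebra F G)))
  have htr := (LinearMap.isNilpotent_trace_of_isNilpotent hT).eq_zero
  rw [LinearMap.trace_eq_matrix_trace F (MonoidAlgebra.basis G F), Matrix.trace] at htr
  rw [← htr]
  refine Fintype.sum_equiv (Equiv.inv G) _ _ fun h ↦ ?_
  rw [Equiv.inv_apply]
  have : (LinearMap.toMatrix (MonoidAlgebra.basis G F) (MonoidAlgebra.basis G F) T) h⁻¹ h⁻¹ =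
      (T (.single h⁻¹ 1)).coeff h⁻¹ := by
    simp [LinearMap.toMatrix_apply, MonoidAlgebra.basis]
  rw [Matrix.diag_apply, this]
  simp [T, a, mul_assoc]
  rw [hz.coeff_mul_comm]
  simp [mul_assoc]

/-- Class functions supported on elements whose centralizer has order prime to `p` annihilate
the nilpotent class functions. -/
theorem mul_eq_zero_of_not_dvd_card_centralizer [Fintype G] {p : ℕ} [CharP F p]
    {a z : MonoidAlgebra F G} (ha : IsClassFunction a)
    (hp : ∀ g, a.coeff g ≠ 0 → ¬ p ∣ Nat.card (Subgroup.centralizer {g}))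
    (hz : IsClassFunction z) (hnil : IsNilpotent z) : a * z = 0 := by
  ext g
  rw [MonoidAlgebra.coeff_mul_eq_sum]
  refine sum_eq_zero_of_sum_orbit_eq_zero (R := ConjAct G) _ fun x ↦ ?_
  have hc (y : MulAction.orbit (ConjAct G) x) :
      a.coeff y * z.coeff ((y : G)⁻¹ * g) = a.coeff x * z.coeff ((y : G)⁻¹ * g) := by
    obtain ⟨y, r, rfl⟩ := y
    simp only [ConjAct.smul_def, ha (ConjAct.ofConjAct r) x]
  rw [Finset.sum_congr rfl fun y _ ↦ hc y, ← Finset.mul_sum, mul_eq_zero, or_iff_not_imp_left]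
  intro hx
  have h1 := sum_smul_eq_card_stabilizer_mul_sum_orbit (R := ConjAct G)
    (fun y ↦ z.coeff (y⁻¹ * g)) x
  have h2 : ∑ r : ConjAct G, z.coeff ((r • x)⁻¹ * g) = 0 := by
    rw [← sum_coeff_conj_mul_eq_zero hz hnil x⁻¹ g]
    exact Fintype.sum_equiv ConjAct.ofConjAct.toEquiv _ _ fun r ↦ by
      simp [ConjAct.smul_def, mul_assoc]
  rw [h2, eq_comm, mul_eq_zero] at h1
  refine h1.resolve_left fun h ↦ hp x hx ?_
  rwa [CharP.cast_eq_zero_iff F p, ConjAct.stabilizer_eq_centralizer] at h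

end ClassFunctions

section BoundedDefect

variable {F G : Type*} [Field F] [Group G]

/-- The class functions supported on elements `g` such that every `p`-subgroup centralizing `g`
is conjugate to a subgroup of `P`. -/
def boundedDefect (F : Type*) [Field F] (p : ℕ) (P : Subgroup G) :
    Submodule F (MonoidAlgebra F G) where
  carrier := {a | IsClassFunction a ∧ ∀ g, a.coeff g ≠ 0 → ∀ R : Subgroup G, IsPGroup p R →
    g ∈ Subgroup.centralizer (R : Set G) → ∃ h : G, R.map (MulAut.conj h).toMonoidHom ≤ P}
  zero_mem' := ⟨fun _ _ ↦ rfl, fun _ h ↦ (h rfl).elim⟩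
  add_mem' := by
    rintro a b ⟨ha, ha'⟩ ⟨hb, hb'⟩
    refine ⟨fun h g ↦ by simp [ha h g, hb h g], fun g hg ↦ ?_⟩
    by_cases h0 : a.coeff g = 0
    · exact hb' g (by simpa [h0] using hg)
    · exact ha' g h0
  smul_mem' := by
    rintro c a ⟨ha, ha'⟩
    refine ⟨fun h g ↦ by simp [ha h g], fun g hg ↦ ha' g fun h0 ↦ hg (by simp [h0])⟩

variable {p : ℕ} {P Z : Subgroup G} {a z : MonoidAlgebra F G}

theorem mul_mem_boundedDefect [Finite G] [Fact p.Prime] [CharP F p]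
    (ha : a ∈ boundedDefect F p P) (hz : IsClassFunction z) :
    a * z ∈ boundedDefect F p P := by
  have := Fintype.ofFinite G
  refine ⟨ha.1.mul hz, fun g hg R hR hgR ↦ ?_⟩
  rw [ha.1.coeff_mul_eq_sum_centralizer hz hR hgR] at hg
  obtain ⟨x, -, hx⟩ := Finset.exists_ne_zero_of_sum_ne_zero hg
  rw [ite_ne_right_iff] at hx
  exact ha.2 x (left_ne_zero_of_mul hx.2) R hR hx.1

theorem mem_of_mem_boundedDefect_of_coeff_ne_zero (hZ : Z ≤ Subgroup.center G)
    (ha : a ∈ boundedDefect F p Z) {g r : G} (hg : a.coeff g ≠ 0) (hr : Commute r g)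
    (hrp : ∃ k, r ^ p ^ k = 1) : r ∈ Z := by
  obtain ⟨k, hk⟩ := hrp
  have hp : IsPGroup p (Subgroup.zpowers r) := by
    rw [isPGroup_iff_pow_pow_eq_one]
    rintro ⟨x, n, rfl⟩
    exact ⟨k, Subtype.ext <| show (r ^ n) ^ p ^ k = 1 by
      rw [← zpow_natCast, zpow_comm, zpow_natCast, hk, one_zpow]⟩
  obtain ⟨h, hh⟩ := ha.2 g hg (Subgroup.zpowers r) hp <| by
    rw [Subgroup.mem_centralizer_iff]
    rintro _ ⟨n, rfl⟩
    exact hr.zpow_left n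
  have h1 : h * r * h⁻¹ ∈ Z := hh ⟨r, Subgroup.mem_zpowers r, rfl⟩
  have h2 : r ∈ Subgroup.center G := by
    simpa [mul_assoc] using Subgroup.Normal.conj_mem inferInstance _ (hZ h1) h⁻¹
  rwa [Subgroup.mem_center_iff.1 h2 h, mul_inv_cancel_right] at h1

/-- In a finite group, taking `p`-parts of elements is a power map. -/
theorem exists_pow_eq_pPart (G : Type*) [Group G] [Finite G] (p : ℕ) [hp : Fact p.Prime] :
    ∃ e : ℕ, (∀ g : G, ∃ k, (g ^ e) ^ p ^ k = 1) ∧ ∀ g : G, (∃ k, g ^ p ^ k = 1) → g ^ e = g := by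
  obtain ⟨k, m, hm, hcard⟩ :=
    Nat.exists_eq_pow_mul_and_not_dvd (Nat.card_pos (α := G)).ne' p hp.out.ne_one
  have hco : Nat.Coprime (p ^ k) m := ((Nat.Prime.coprime_iff_not_dvd hp.out).2 hm).pow_left k
  obtain ⟨e, he, he'⟩ := Nat.chineseRemainder hco 1 0
  refine ⟨e, fun g ↦ ⟨k, ?_⟩, fun g ⟨j, hj⟩ ↦ ?_⟩
  · obtain ⟨c, rfl⟩ := (Nat.modEq_zero_iff_dvd).1 he'
    rw [← pow_mul, show m * c * p ^ k = p ^ k * m * c by ring, ← hcard, pow_mul, pow_card_eq_one',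
      one_pow]
  · have h1 : orderOf g ∣ p ^ k := by
      refine Nat.Coprime.dvd_of_dvd_mul_right ?_ (hcard ▸ orderOf_dvd_natCard g)
      exact Nat.Coprime.coprime_dvd_left (orderOf_dvd_of_pow_eq_one hj)
        (((Nat.Prime.coprime_iff_not_dvd hp.out).2 hm).pow_left j)
    simpa using pow_eq_pow_iff_modEq.2 (he.of_dvd h1)

theorem coeff_mapDomainRingHom_mk [Fintype G] [Z.Normal] (a : MonoidAlgebra F G) (g : G) :
    (MonoidAlgebra.mapDomainRingHom F (QuotientGroup.mk' Z) a).coeff (g : G ⧸ Z) =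
      ∑ v : Z, a.coeff (g * v) := by
  have h1 : (MonoidAlgebra.mapDomainRingHom F (QuotientGroup.mk' Z) a).coeff (g : G ⧸ Z) =
      ∑ x : G, if (x : G ⧸ Z) = g then a.coeff x else 0 := by
    simp [Finsupp.mapDomain, Finsupp.sum_fintype, Finsupp.finsetSum_apply, Finsupp.single_apply]
  rw [h1, ← Finset.sum_filter]
  symm
  refine Finset.sum_bij (fun v _ ↦ g * v) ?_ ?_ ?_ fun _ _ ↦ rfl
  · rintro ⟨v, hv⟩ -
    simp [hv]
  · rintro v - w - h
    exact Subtype.ext (mul_left_cancel h)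
  · intro x hx
    have hx : (g : G ⧸ Z) = x := by simpa [eq_comm] using hx
    exact ⟨⟨g⁻¹ * x, QuotientGroup.eq.1 hx⟩, Finset.mem_univ _, by simp⟩

variable [Fintype G] [Fact p.Prime]

/-- Modulo a central `p`-subgroup `Z`, the class functions of defect `Z` annihilate the nilpotent
class functions. -/
theorem mapDomainRingHom_mul_eq_zero [CharP F p] (hZ : Z ≤ Subgroup.center G) [Z.Normal]
    (hZp : IsPGroup p Z)
    (ha : a ∈ boundedDefect F p Z) (hz : IsClassFunction z) (hnil : IsNilpotent z) :
    MonoidAlgebra.mapDomainRingHom F (QuotientGroup.mk' Z) (a * z) = 0 := by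
  have hsurj := QuotientGroup.mk'_surjective Z
  rw [map_mul]
  refine mul_eq_zero_of_not_dvd_card_centralizer (p := p) (ha.1.map hsurj) ?_ (hz.map hsurj)
    (hnil.map _)
  obtain ⟨e, he, he'⟩ := exists_pow_eq_pPart G p
  rw [isPGroup_iff_pow_pow_eq_one] at hZp
  have hZp' : ∀ v ∈ Z, ∃ k, v ^ p ^ k = 1 := fun v hv ↦ (hZp ⟨v, hv⟩).imp fun k hk ↦ by
    simpa using congrArg Subtype.val hk
  intro h hh hdvd
  obtain ⟨g, rfl⟩ := QuotientGroup.mk_surjective h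
  rw [coeff_mapDomainRingHom_mk] at hh
  obtain ⟨v, -, hv⟩ := Finset.exists_ne_zero_of_sum_ne_zero hh
  rw [show (g : G ⧸ Z) = (g * v : G) by simp] at hdvd
  generalize g * (v : G) = g at hdvd hv
  obtain ⟨⟨y, hy⟩, hyp⟩ := exists_prime_orderOf_dvd_card' p hdvd
  rw [Subgroup.orderOf_mk] at hyp
  obtain ⟨r, rfl⟩ := QuotientGroup.mk_surjective y
  rw [Subgroup.mem_centralizer_singleton_iff] at hy
  obtain ⟨u, hu, hru⟩ : ∃ u ∈ Z, r * g * r⁻¹ = g * u := by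
    refine ⟨g⁻¹ * (r * g * r⁻¹), QuotientGroup.eq.1 ?_, by group⟩
    rw [QuotientGroup.mk_mul, QuotientGroup.mk_mul, QuotientGroup.mk_inv, eq_mul_inv_iff_mul_eq]
    exact hy.symm
  have hge : g ^ e ∈ Z :=
    mem_of_mem_boundedDefect_of_coeff_ne_zero hZ ha hv (Commute.pow_self g e) (he g)
  have h1 : (r * g * r⁻¹) ^ e = g ^ e := by
    rw [conj_pow, Subgroup.mem_center_iff.1 (hZ hge) r, mul_inv_cancel_right]
  have hgu : Commute g u := Subgroup.mem_center_iff.1 (hZ hu) g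
  rw [hru, hgu.mul_pow, mul_eq_left, he' u (hZp' u hu)] at h1
  have hrg : Commute r g := by
    rw [h1, mul_one, mul_inv_eq_iff_eq_mul] at hru
    exact hru
  have hrp : r ^ p ∈ Z := by
    rw [← QuotientGroup.eq_one_iff, QuotientGroup.mk_pow, ← hyp, pow_orderOf_eq_one]
  have hr : r ∈ Z := mem_of_mem_boundedDefect_of_coeff_ne_zero hZ ha hv hrg <| by
    obtain ⟨k, hk⟩ := hZp' _ hrp
    exact ⟨k + 1, by rwa [pow_succ', pow_mul]⟩
  rw [(QuotientGroup.eq_one_iff r).2 hr, orderOf_one] at hyp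
  exact (Fact.out : p.Prime).ne_one hyp.symm

/-- A class function of central defect `Z` whose image modulo `Z` vanishes lies in the product of
the augmentation ideal of `Z` with the class functions of defect `Z`. -/
theorem mem_augmentation_mul_boundedDefect (hZ : Z ≤ Subgroup.center G) (hZp : IsPGroup p Z)
    (ha : a ∈ boundedDefect F p Z) (hsum : ∀ g, ∑ v : Z, a.coeff (g * v) = 0) :
    a ∈ Submodule.span F {b | ∃ v ∈ Z, b = MonoidAlgebra.single v (1 : F) - 1} *
      boundedDefect F p Z := by
  obtain ⟨e, he, he'⟩ := exists_pow_eq_pPart G p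
  rw [isPGroup_iff_pow_pow_eq_one] at hZp
  have hZe : ∀ v ∈ Z, v ^ e = v := fun v hv ↦ he' v <| (hZp ⟨v, hv⟩).imp fun k hk ↦ by
    simpa using congrArg Subtype.val hk
  have hcomm (v : Z) (g : G) : Commute g v := Subgroup.mem_center_iff.1 (hZ v.2) g
  let b (v : Z) : MonoidAlgebra F G := .ofCoeff <| Finsupp.equivFunOnFinite.symm fun k ↦
    if k ^ e = 1 then a.coeff (k * v) else 0
  have hb (v : Z) (k : G) : (b v).coeff k = if k ^ e = 1 then a.coeff (k * v) else 0 := rfl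
  have hb_mem (v : Z) : b v ∈ boundedDefect F p Z := by
    refine ⟨fun h g ↦ ?_, fun g hg R hR hgR ↦ ?_⟩
    · have h1 : h * g * h⁻¹ * v = h * (g * v) * h⁻¹ := by
        rw [mul_assoc, (hcomm v h⁻¹).eq]
        group
      simp only [hb, h1, ha.1 h, conj_pow, conj_eq_one_iff]
    · rw [hb, ite_ne_right_iff] at hg
      exact ha.2 _ hg.2 R hR
        (mul_mem hgR (Subgroup.center_le_centralizer _ (hZ v.2)))
  have key : a = ∑ v : Z, (MonoidAlgebra.single (v : G) (1 : F) - 1) * b v := by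
    ext k
    have h1 : ∑ v : Z, (b v).coeff k = 0 := by
      simp only [hb]
      split_ifs
      · exact hsum k
      · simp
    have h2 (v : Z) : (b v).coeff ((v : G)⁻¹ * k) = if k ^ e = v then a.coeff k else 0 := by
      rw [hb, ((hcomm v k).symm.inv_left).mul_pow, inv_pow, hZe v v.2, inv_mul_eq_one]
      rw [mul_assoc, (hcomm v k).eq, inv_mul_cancel_left]
      simp only [eq_comm]
    have h3 : ∑ v : Z, (b v).coeff ((v : G)⁻¹ * k) = a.coeff k := by
      simp only [h2]
      by_cases h0 : a.coeff k = 0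
      · simp [h0]
      · have hk : k ^ e ∈ Z :=
          mem_of_mem_boundedDefect_of_coeff_ne_zero hZ ha h0 (Commute.pow_self k e) (he k)
        rw [Finset.sum_eq_single ⟨k ^ e, hk⟩]
        · simp
        · rintro v - hv
          exact if_neg fun h ↦ hv (Subtype.ext h.symm)
        · simp
    simp [sub_mul, h1, h3]
  rw [key]
  exact Submodule.sum_mem _ fun v _ ↦
    Submodule.mul_mem_mul (Submodule.subset_span ⟨v, v.2, rfl⟩) (hb_mem v)

theorem mul_mem_augmentation_mul_boundedDefect [CharP F p] (hZ : Z ≤ Subgroup.center G)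
    (hZp : IsPGroup p Z)
    (ha : a ∈ boundedDefect F p Z) (hz : IsClassFunction z) (hnil : IsNilpotent z) :
    a * z ∈ Submodule.span F {b | ∃ v ∈ Z, b = MonoidAlgebra.single v (1 : F) - 1} *
      boundedDefect F p Z := by
  have : Z.Normal := ⟨fun v hv g ↦ by
    rwa [Subgroup.mem_center_iff.1 (hZ hv) g, mul_inv_cancel_right]⟩
  refine mem_augmentation_mul_boundedDefect hZ hZp (mul_mem_boundedDefect ha hz) fun g ↦ ?_
  rw [← coeff_mapDomainRingHom_mk, mapDomainRingHom_mul_eq_zero hZ hZp ha hz hnil]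
  rfl

end BoundedDefect

section BrauerMap

variable {F G : Type*} [Field F] [Group G]

/-- The Brauer map, restricting elements of `FG` to a subgroup `C`. It is used for
`C = C_G(P)`. -/
noncomputable def brauerMap (F : Type*) [Field F] (C : Subgroup G) :
    MonoidAlgebra F G →ₗ[F] MonoidAlgebra F C where
  toFun := MonoidAlgebra.comapDomain C.subtype C.subtype_injective
  map_add' _ _ := by ext; simp
  map_smul' _ _ := by ext; simp

@[simp]
theorem coeff_brauerMap (C : Subgroup G) (a : MonoidAlgebra F G) (c : C) :
    (brauerMap F C a).coeff c = a.coeff c :=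
  rfl

variable {p : ℕ} {P : Subgroup G} {a b : MonoidAlgebra F G}

theorem IsClassFunction.brauerMap {C : Subgroup G} (ha : IsClassFunction a) :
    IsClassFunction (brauerMap F C a) := fun h g ↦ by
  simpa using ha (h : G) g

theorem brauerMap_mul [Finite G] [Fact p.Prime] [CharP F p] (hP : IsPGroup p P)
    (ha : IsClassFunction a) (hb : IsClassFunction b) :
    brauerMap F (Subgroup.centralizer (P : Set G)) (a * b) =
      brauerMap F (Subgroup.centralizer (P : Set G)) a *
        brauerMap F (Subgroup.centralizer (P : Set G)) b := by
  have := Fintype.ofFinite G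
  have := Fintype.ofFinite (Subgroup.centralizer (P : Set G))
  ext g
  rw [coeff_brauerMap, ha.coeff_mul_eq_sum_centralizer hb hP g.2,
    MonoidAlgebra.coeff_mul_eq_sum, ← Finset.sum_filter]
  exact Finset.sum_subtype _ (by simp) _

theorem isNilpotent_brauerMap [Finite G] [Fact p.Prime] [CharP F p] (hP : IsPGroup p P)
    (ha : IsClassFunction a) (hnil : IsNilpotent a) :
    IsNilpotent (brauerMap F (Subgroup.centralizer (P : Set G)) a) := by
  obtain ⟨n, hn⟩ := hnil
  have key (k : ℕ) : IsClassFunction (a ^ (k + 1)) ∧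
      brauerMap F (Subgroup.centralizer (P : Set G)) (a ^ (k + 1)) =
        brauerMap F (Subgroup.centralizer (P : Set G)) a ^ (k + 1) := by
    induction k with
    | zero => simpa using ha
    | succ k ih =>
      rw [pow_succ a, pow_succ (brauerMap F _ a)]
      exact ⟨ih.1.mul ha, by rw [brauerMap_mul hP ih.1 ha, ih.2]⟩
  exact ⟨n + 1, by rw [← (key n).2, pow_succ, hn, zero_mul, map_zero]⟩

theorem brauerMap_mem_boundedDefect [Finite G] (hP : IsPGroup p P) (ha : a ∈ boundedDefect F p P) :
    brauerMap F (Subgroup.centralizer (P : Set G)) a ∈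
      boundedDefect F p (P.subgroupOf (Subgroup.centralizer (P : Set G))) := by
  set C := Subgroup.centralizer (P : Set G)
  refine ⟨ha.1.brauerMap, fun c hc R hR hcR ↦ ⟨1, ?_⟩⟩
  rw [coeff_brauerMap] at hc
  have hRC : R.map C.subtype ≤ C := Subgroup.map_subtype_le R
  have hsup : IsPGroup p (R.map C.subtype ⊔ P : Subgroup G) :=
    (hR.map C.subtype).to_sup_of_normal_right' hP
      (hRC.trans (Subgroup.centralizer_le_normalizer _))
  have hle : R.map C.subtype ⊔ P ≤ Subgroup.centralizer {(c : G)} := by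
    rw [sup_le_iff]
    constructor
    · rintro _ ⟨r, hr, rfl⟩
      rw [Subgroup.mem_centralizer_singleton_iff]
      exact congrArg Subtype.val (Subgroup.mem_centralizer_iff.1 hcR r hr)
    · intro x hx
      rw [Subgroup.mem_centralizer_singleton_iff]
      exact Subgroup.mem_centralizer_iff.1 c.2 x hx
  obtain ⟨h, hh⟩ := ha.2 c hc _ hsup <| by
    rw [Subgroup.mem_centralizer_iff]
    exact fun x hx ↦ Subgroup.mem_centralizer_singleton_iff.1 (hle hx)
  have hcard : Nat.card (R.map C.subtype ⊔ P : Subgroup G) ≤ Nat.card P := by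
    rw [← Subgroup.card_map_of_injective (f := (MulAut.conj h).toMonoidHom)
      (MulAut.conj h).injective]
    exact Subgroup.card_le_of_le hh
  have heq := Subgroup.eq_of_le_of_card_ge le_sup_right hcard
  rintro _ ⟨r, hr, rfl⟩
  have : (r : G) ∈ P := heq ▸ Subgroup.mem_sup_left ⟨r, hr, rfl⟩
  simpa [Subgroup.mem_subgroupOf] using this

/-- The augmentation ideal of `F·Z(P)` is contained in the Jacobson radical of `F·Z(P)`, so its
powers vanish accordingly. -/
theorem augmentation_pow_eq_bot [Fact p.Prime] [CharP F p] (hP : IsPGroup p P) {n : ℕ}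
    (hn : (Ideal.jacobson (⊥ : Ideal (MonoidAlgebra F (Subgroup.center P)))) ^ n = ⊥) :
    (Submodule.span F {b | ∃ v ∈ P.subgroupOf (Subgroup.centralizer (P : Set G)),
      b = MonoidAlgebra.single v (1 : F) - 1}) ^ n = ⊥ := by
  set C := Subgroup.centralizer (P : Set G)
  let A := MonoidAlgebra F (Subgroup.center P)
  have hn0 : n ≠ 0 := by
    rintro rfl
    rw [Submodule.pow_zero, Submodule.one_eq_span, Submodule.span_singleton_eq_bot] at hn
    exact one_ne_zero hn
  have : CharP A p := charP_of_injective_algebraMap (FaithfulSMul.algebraMap_injective F A) p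
  let ι : Subgroup.center P →* C := (P.subtype.comp (Subgroup.center P).subtype).codRestrict C
    fun v ↦ Subgroup.mem_centralizer_iff.2 fun x hx ↦
      congrArg Subtype.val (Subgroup.mem_center_iff.1 v.2 ⟨x, hx⟩)
  let φ : A →ₐ[F] MonoidAlgebra F C := MonoidAlgebra.mapDomainAlgHom F F ι
  rw [eq_bot_iff]
  calc _ ≤ (Submodule.map φ.toLinearMap
        ((Ideal.jacobson (⊥ : Ideal A)).restrictScalars F)) ^ n := by
        refine pow_le_pow_left' (Submodule.span_le.2 ?_) n
        rintro _ ⟨v, hv, rfl⟩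
        let w : Subgroup.center P := ⟨⟨v, hv⟩, Subgroup.mem_center_iff.2 fun x ↦
          Subtype.ext (Subgroup.mem_centralizer_iff.1 v.2 x x.2)⟩
        refine ⟨MonoidAlgebra.single w 1 - 1, ?_, ?_⟩
        · have hnil : IsNilpotent (MonoidAlgebra.single w 1 - 1 : A) := by
            obtain ⟨k, hk⟩ := (isPGroup_iff_pow_pow_eq_one.1 (hP.to_subgroup _)) w
            refine ⟨p ^ k, ?_⟩
            rw [sub_pow_char_pow_of_commute _ _ (Commute.one_right _), MonoidAlgebra.single_pow, hk,
              one_pow, one_pow, MonoidAlgebra.one_def, sub_self]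
          open scoped IsMulCommutative in
          exact (Ideal.mem_jacobson_bot (R := A)).2 fun y ↦
            ((Commute.all _ y).isNilpotent_mul_right hnil).isUnit_add_one
        · change φ (MonoidAlgebra.single w 1 - 1) = _
          rw [map_sub, map_one]
          exact congrArg (· - 1) (MonoidAlgebra.mapDomain_single ..)
    _ = ⊥ := by
        rw [← Submodule.map_pow, ← Submodule.restrictScalars_pow hn0, hn,
          Submodule.restrictScalars_bot, Submodule.map_bot]

end BrauerMap

section ClassSums

theorem mk_conj_eq {G : Type*} [Group G] (h g : G) :
    ConjClasses.mk (h * g * h⁻¹) = ConjClasses.mk g :=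
  ConjClasses.mk_eq_mk_iff_isConj.2 (isConj_iff.2 ⟨h, rfl⟩).symm

variable {F G : Type} [Field F] [Group G] [Fintype G] {p : ℕ} {P : Subgroup G}

theorem coeff_classSum (K : ConjClasses G) (g : G) :
    (classSum F K).coeff g = if g ∈ K.carrier then 1 else 0 := by
  simp only [classSum, MonoidAlgebra.coeff_sum, Finsupp.finsetSum_apply]
  rw [Finset.sum_eq_single g]
  · split_ifs <;> simp
  · intro x _ hx
    split_ifs <;> simp [hx]
  · simp

theorem IsClassFunction.eq_sum_classSum {a : MonoidAlgebra F G} (ha : IsClassFunction a) :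
    a = ∑ K : ConjClasses G, a.coeff K.out • classSum F K := by
  ext g
  rw [MonoidAlgebra.coeff_sum, Finsupp.finsetSum_apply,
    Finset.sum_eq_single (ConjClasses.mk g)]
  · obtain ⟨h, hh⟩ := isConj_iff.1 (ConjClasses.mk_eq_mk_iff_isConj.1
      (Quotient.out_eq (ConjClasses.mk g)))
    rw [MonoidAlgebra.coeff_smul_apply, coeff_classSum, if_pos ConjClasses.mem_carrier_mk,
      smul_eq_mul, mul_one]
    nth_rw 1 [← hh]
    exact ha _ _
  · intro K _ hK
    rw [MonoidAlgebra.coeff_smul_apply, coeff_classSum,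
      if_neg fun h ↦ hK (ConjClasses.mem_carrier_iff_mk_eq.1 h).symm, smul_zero]
  · simp

variable [Fact p.Prime]

theorem classIdealLE_le_boundedDefect : classIdealLE F p P ≤ boundedDefect F p P := by
  refine iSup₂_le fun Q hQP ↦ Submodule.span_le.2 ?_
  rintro _ ⟨K, ⟨x, hx, S, rfl⟩, rfl⟩
  refine ⟨fun h g ↦ ?_, fun g hg R hR hgR ↦ ?_⟩
  · simp only [coeff_classSum, ConjClasses.mem_carrier_iff_mk_eq, mk_conj_eq]
  · have hgK : g ∈ K.carrier := by
      by_contra h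
      exact hg (by rw [coeff_classSum, if_neg h])
    rw [ConjClasses.mem_carrier_iff_mk_eq] at hx hgK
    obtain ⟨h, rfl⟩ := isConj_iff.1 (ConjClasses.mk_eq_mk_iff_isConj.1 (hgK.trans hx.symm))
    have hle : ∀ r ∈ R, h * r * h⁻¹ ∈ Subgroup.centralizer {h * g * h⁻¹} := fun r hr ↦ by
      have := Subgroup.mem_centralizer_iff.1 hgR r hr
      rw [Subgroup.mem_centralizer_singleton_iff, conj_mul, conj_mul, this]
    obtain ⟨T, hT⟩ := ((hR.map (MulAut.conj h).toMonoidHom).comap_subtype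
      (K := Subgroup.centralizer {h * g * h⁻¹})).exists_le_sylow
    obtain ⟨t, ht⟩ := MulAction.exists_smul_eq (Subgroup.centralizer {h * g * h⁻¹}) T S
    refine ⟨t * h, le_trans ?_ hQP⟩
    rintro _ ⟨r, hr, rfl⟩
    have h1 : (⟨h * r * h⁻¹, hle r hr⟩ : Subgroup.centralizer {h * g * h⁻¹}) ∈ T :=
      hT ⟨r, hr, rfl⟩
    refine ⟨t * ⟨h * r * h⁻¹, hle r hr⟩ * t⁻¹, ?_, by simp [mul_assoc]⟩
    rw [← ht]
    exact ⟨_, h1, rfl⟩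

theorem isClassDefectGroup_map_conj {K : ConjClasses G} {Q : Subgroup G}
    (hQ : IsClassDefectGroup p Q K) (h : G) :
    IsClassDefectGroup p (Q.map (MulAut.conj h).toMonoidHom) K := by
  obtain ⟨x, hx, S, rfl⟩ := hQ
  let f : Subgroup.centralizer {x} →* Subgroup.centralizer {h * x * h⁻¹} :=
    ((MulAut.conj h).toMonoidHom.comp (Subgroup.centralizer {x}).subtype).codRestrict _ fun r ↦ by
      have := Subgroup.mem_centralizer_singleton_iff.1 r.2
      rw [Subgroup.mem_centralizer_singleton_iff]
      change h * r * h⁻¹ * (h * x * h⁻¹) = h * x * h⁻¹ * (h * r * h⁻¹)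
      rw [conj_mul, conj_mul, this]
  have hf : Function.Surjective f := fun r ↦ by
    have := Subgroup.mem_centralizer_singleton_iff.1 r.2
    refine ⟨⟨h⁻¹ * r * h, ?_⟩, Subtype.ext (by simp [f, mul_assoc])⟩
    rw [Subgroup.mem_centralizer_singleton_iff]
    calc h⁻¹ * r * h * x = h⁻¹ * (r * (h * x * h⁻¹)) * h := by group
      _ = x * (h⁻¹ * r * h) := by rw [this]; group
  refine ⟨h * x * h⁻¹, ?_, S.mapSurjective hf, ?_⟩
  · rwa [ConjClasses.mem_carrier_iff_mk_eq, mk_conj_eq, ← ConjClasses.mem_carrier_iff_mk_eq]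
  · rw [Sylow.coe_mapSurjective, Subgroup.map_map, Subgroup.map_map]
    rfl

theorem mem_classIdealLT_of_brauerMap_eq_zero {a : MonoidAlgebra F G}
    (ha : a ∈ boundedDefect F p P)
    (h0 : brauerMap F (Subgroup.centralizer (P : Set G)) a = 0) : a ∈ classIdealLT F p P := by
  rw [ha.1.eq_sum_classSum]
  refine Submodule.sum_mem _ fun K _ ↦ ?_
  by_cases hK : a.coeff K.out = 0
  · rw [hK, zero_smul]
    exact zero_mem _
  refine Submodule.smul_mem _ _ ?_
  obtain ⟨S⟩ : Nonempty (Sylow p (Subgroup.centralizer {K.out})) := inferInstance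
  set Q : Subgroup G := S.toSubgroup.map (Subgroup.centralizer {K.out}).subtype
  have hQc : ∀ r ∈ Q, r * K.out = K.out * r := by
    rintro _ ⟨r, -, rfl⟩
    exact Subgroup.mem_centralizer_singleton_iff.1 r.2
  have hdef : IsClassDefectGroup p Q K :=
    ⟨K.out, ConjClasses.mem_carrier_iff_mk_eq.2 (Quotient.out_eq K), S, rfl⟩
  obtain ⟨h, hh⟩ := ha.2 _ hK Q (S.2.map _) (Subgroup.mem_centralizer_iff.2 hQc)
  have hlt : Q.map (MulAut.conj h).toMonoidHom < P := by
    refine lt_of_le_of_ne hh fun heq ↦ hK ?_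
    have hc : h * K.out * h⁻¹ ∈ Subgroup.centralizer (P : Set G) := by
      rw [Subgroup.mem_centralizer_iff, ← heq]
      rintro _ ⟨r, hr, rfl⟩
      change h * r * h⁻¹ * (h * K.out * h⁻¹) = h * K.out * h⁻¹ * (h * r * h⁻¹)
      rw [conj_mul, conj_mul, hQc r hr]
    rw [← ha.1 h, ← coeff_brauerMap _ a ⟨_, hc⟩, h0]
    rfl
  exact Submodule.mem_iSup_of_mem _ (Submodule.mem_iSup_of_mem hlt
    (Submodule.subset_span ⟨K, isClassDefectGroup_map_conj hdef h, rfl⟩))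

theorem isClassFunction_and_isNilpotent_of_mem_JZ {z : MonoidAlgebra F G} (hz : z ∈ JZ F G) :
    IsClassFunction z ∧ IsNilpotent z := by
  obtain ⟨y, hy, rfl⟩ := hz
  refine ⟨isClassFunction_iff_mem_center.2 y.2, ?_⟩
  have : FiniteDimensional F (MonoidAlgebra F G) := .of_basis (MonoidAlgebra.basis G F)
  have : IsArtinianRing (Subalgebra.center F (MonoidAlgebra F G)) := IsArtinianRing.of_finite F _
  obtain ⟨n, hn⟩ := IsArtinianRing.isNilpotent_jacobson_bot
    (R := Subalgebra.center F (MonoidAlgebra F G))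
  have hyn : IsNilpotent y := by
    refine ⟨n, ?_⟩
    have := Ideal.pow_mem_pow hy n
    rwa [hn] at this
  exact hyn.map (Subalgebra.center F (MonoidAlgebra F G)).val

theorem classIdealLE_mul_JZ_pow_le [CharP F p] (hP : IsPGroup p P) (n : ℕ) :
    classIdealLE F p P * JZ F G ^ n ≤ boundedDefect F p P ⊓
      Submodule.comap (brauerMap F (Subgroup.centralizer (P : Set G)))
        ((Submodule.span F {b | ∃ v ∈ P.subgroupOf (Subgroup.centralizer (P : Set G)),
            b = MonoidAlgebra.single v (1 : F) - 1}) ^ n *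
          boundedDefect F p (P.subgroupOf (Subgroup.centralizer (P : Set G)))) := by
  induction n with
  | zero =>
    rw [pow_zero, pow_zero, mul_one, one_mul]
    exact fun a ha ↦ ⟨classIdealLE_le_boundedDefect ha,
      brauerMap_mem_boundedDefect hP (classIdealLE_le_boundedDefect ha)⟩
  | succ n ih =>
    rw [pow_succ, ← mul_assoc, Submodule.mul_le]
    intro a ha z hz
    obtain ⟨ha, ha'⟩ := ih ha
    obtain ⟨hz, hnil⟩ := isClassFunction_and_isNilpotent_of_mem_JZ hz
    refine ⟨mul_mem_boundedDefect ha hz, ?_⟩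
    refine Submodule.mem_comap.2 ?_
    rw [brauerMap_mul hP ha.1 hz]
    have hZ : P.subgroupOf (Subgroup.centralizer (P : Set G)) ≤ Subgroup.center _ :=
      fun v hv ↦ Subgroup.mem_center_iff.2 fun c ↦
        Subtype.ext (Subgroup.mem_centralizer_iff.1 c.2 v hv).symm
    have hle : (boundedDefect F p (P.subgroupOf (Subgroup.centralizer (P : Set G)))) *
        Submodule.span F {brauerMap F (Subgroup.centralizer (P : Set G)) z} ≤
        Submodule.span F {b | ∃ v ∈ P.subgroupOf (Subgroup.centralizer (P : Set G)),
            b = MonoidAlgebra.single v (1 : F) - 1} *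
          boundedDefect F p (P.subgroupOf (Subgroup.centralizer (P : Set G))) := by
      rw [Submodule.mul_le]
      intro b hb y hy
      obtain ⟨c, rfl⟩ := Submodule.mem_span_singleton.1 hy
      rw [mul_smul_comm]
      exact Submodule.smul_mem _ _ (mul_mem_augmentation_mul_boundedDefect hZ hP.comap_subtype hb
        hz.brauerMap (isNilpotent_brauerMap hP hz hnil))
    rw [pow_succ, mul_assoc]
    refine mul_le_mul_right hle _ ?_
    rw [← mul_assoc]
    exact Submodule.mul_mem_mul ha' (Submodule.mem_span_singleton_self _)

end ClassSums

/-- If `P` is a `p`-subgroup of `G` and `J(F·Z(P))^n = 0`, then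
`I_{≤P}(G) · J(Z(FG))^n ⊆ I_{<P}(G)`. -/
theorem stmt1 (F : Type) [Field F] [IsAlgClosed F] (G : Type) [Group G] [Fintype G]
    (p : ℕ) [Fact p.Prime] [CharP F p]
    (P : Subgroup G) (hP : IsPGroup p P) (n : ℕ)
    (hn : (Ideal.jacobson (⊥ : Ideal (MonoidAlgebra F ↥(Subgroup.center ↥P)))) ^ n = ⊥) :
    classIdealLE F p P * (JZ F G) ^ n ≤ classIdealLT F p P := by
  refine (classIdealLE_mul_JZ_pow_le hP n).trans fun a ha ↦ ?_
  refine mem_classIdealLT_of_brauerMap_eq_zero ha.1 ?_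
  have h := Submodule.mem_comap.1 ha.2
  rwa [augmentation_pow_eq_bot hP hn, Submodule.bot_mul, Submodule.mem_bot] at h
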